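/- Let p be an odd prime and let (j_k)_{k≥0} be any sequence of odd integers with 1 ≤ j_k ≤ p−2 for all k. Then for every integer n ≥ 2, lim_{k→∞} e_{j_k p^k, n}(Θ_p) = 1; in particular the sequence of diagonals {j_k p^k}_{k≥0} exhibits full escape of mass: lim_{n→∞} lim_{k→∞} e_{j_k p^k, n}(Θ_p) = 1. -/

import Mathlib

open scoped Classical
open Filter Polynomial

noncomputable section

namespace EscapeOfMass

variable {K : Type*} [Field K]

/-- The element `t` of `K((t⁻¹))`, modelled as the Laurent series field `K⸨X⸩`
in the variable `X = t⁻¹`; thus `t = X⁻¹ = single (-1) 1`. -/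
def tLS (K : Type*) [Field K] : LaurentSeries K := HahnSeries.single (-1 : ℤ) 1

/-- The polynomial part of a Laurent series in `K((t⁻¹))` (the terms with
non-negative powers of `t`, i.e. non-positive powers of `X`). -/
def polyPart (f : LaurentSeries K) : LaurentSeries K :=
  { coeff := fun n => if n ≤ 0 then f.coeff n else 0
    isPWO_support' := by
      refine f.isPWO_support'.mono fun n hn => ?_
      simp only [Function.mem_support, ne_eq] at hn ⊢
      intro h
      exact hn (by simp [h]) }

/-- The fractional part `⟨f⟩` of a Laurent series in `K((t⁻¹))`. -/
def fracPart (f : LaurentSeries K) : LaurentSeries K := f - polyPart f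

/-- The complete quotients of the continued fraction expansion of `f`. -/
def cfQuot (f : LaurentSeries K) : ℕ → LaurentSeries K
  | 0 => f
  | i + 1 => (cfQuot f i - polyPart (cfQuot f i))⁻¹

/-- The partial quotients `A_i` of the continued fraction expansion of `f`. -/
def cfPQ (f : LaurentSeries K) (i : ℕ) : LaurentSeries K := polyPart (cfQuot f i)

/-- The degree (as an integer) of a Laurent series viewed in `K((t⁻¹))`:
for a nonzero polynomial in `t` this is the usual degree. -/
def degZ (f : LaurentSeries K) : ℤ := -f.order

/-- `f` is a rational Laurent series, i.e. lies in `K(t)`. -/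
def IsRatLS (f : LaurentSeries K) : Prop := ∃ r : RatFunc K, (r : LaurentSeries K) = f

/-- `f` is a quadratic irrational: it is irrational and a root of a quadratic
polynomial with coefficients in `K[t]`. -/
def IsQuadIrr (f : LaurentSeries K) : Prop :=
  ¬ IsRatLS f ∧ ∃ a b c : Polynomial K, a ≠ 0 ∧
    Polynomial.aeval (tLS K) a * f ^ 2 + Polynomial.aeval (tLS K) b * f +
      Polynomial.aeval (tLS K) c = 0

/-- `(m, ℓ)` is a window for the periodic part of the continued fraction of `f`:
the partial quotients are periodic with period `ℓ ≥ 1` from index `m + 1` on. -/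
def PeriodWindow (f : LaurentSeries K) (m ℓ : ℕ) : Prop :=
  1 ≤ ℓ ∧ ∀ i : ℕ, m + 1 ≤ i → cfPQ f (i + ℓ) = cfPQ f i

/-- The `n`-escape of mass of the continued fraction expansion of `f`: the proportion,
within one period of the periodic part of the partial quotients of `f`, of the sum
`∑ max (deg A_i - n) 0` relative to `∑ deg A_i`. -/
def eMassOf (f : LaurentSeries K) (n : ℕ) : ℝ :=
  if h : ∃ s : ℕ × ℕ, PeriodWindow f s.1 s.2 then
    (∑ i ∈ Finset.Ico ((Classical.choose h).1 + 1)
        ((Classical.choose h).1 + 1 + (Classical.choose h).2),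
        max ((degZ (cfPQ f i) : ℝ) - n) 0) /
    (∑ i ∈ Finset.Ico ((Classical.choose h).1 + 1)
        ((Classical.choose h).1 + 1 + (Classical.choose h).2),
        (degZ (cfPQ f i) : ℝ))
  else 0

/-- The `n`-escape of mass in the `k`-th diagonal of `f` with respect to the
sequence `{g^k}`. -/
def eMassP (g f : LaurentSeries K) (k n : ℕ) : ℝ := eMassOf (g ^ k * f) n

/-- The `n`-escape of mass in the `k`-th diagonal of `f` with respect to `{t^k}`. -/
def eMass (f : LaurentSeries K) (k n : ℕ) : ℝ := eMassP (tLS K) f k n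

/-- `f` exhibits `c` escape of mass with respect to the sequence `{g^k}`. -/
def ExhibitsEscape (g f : LaurentSeries K) (c : ℝ) : Prop :=
  ∃ L : ℝ, Tendsto (fun n : ℕ => Filter.liminf (fun k : ℕ => eMassP g f k n) atTop)
    atTop (nhds L) ∧ c ≤ L

/-- `f` exhibits exactly `c` escape of mass with respect to the sequence `{g^k}`. -/
def ExhibitsExactEscape (g f : LaurentSeries K) (c : ℝ) : Prop :=
  Tendsto (fun n : ℕ => Filter.liminf (fun k : ℕ => eMassP g f k n) atTop)
    atTop (nhds c)

/-- `f` exhibits full (`c = 1`) maximal escape of mass with respect to `{g^k}`. -/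
def ExhibitsFullMaxEscape (g f : LaurentSeries K) : Prop :=
  Tendsto (fun n : ℕ => Filter.limsup (fun k : ℕ => eMassP g f k n) atTop)
    atTop (nhds 1)

/-- `A ⊆ ℕ` has natural density `c`. -/
def HasDensity (A : Set ℕ) (c : ℝ) : Prop :=
  Tendsto (fun M : ℕ => (((Finset.Icc 1 M).filter fun k => k ∈ A).card : ℝ) / M)
    atTop (nhds c)

/-- `f` exhibits full generic escape of mass with respect to `{t^k}`. -/
def FullGenericEscape (f : LaurentSeries K) : Prop :=
  ∀ ε : ℝ, 0 < ε → ∃ dens : ℕ → ℝ,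
    (∀ n : ℕ, HasDensity {k : ℕ | 1 - ε < eMass f k n} (dens n)) ∧
    Tendsto dens atTop (nhds 1)

/-- Substitution `t ↦ P(t)` on Laurent series: for `f = ∑_{i ≥ d} a_i t^{-i}` (with
`d = f.order` in the variable `X = t⁻¹`), `substLS f P = ∑_{i ≥ d} a_i P(t)^{-i}`. -/
def substLS (f : LaurentSeries K) (P : Polynomial K) : LaurentSeries K :=
  (Polynomial.aeval (tLS K) P)⁻¹ ^ f.order *
    HahnSeries.ofPowerSeries ℤ K
      (PowerSeries.mk fun n =>
        ∑ j ∈ Finset.range (n + 1),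
          f.coeff (f.order + j) * (((Polynomial.aeval (tLS K) P)⁻¹ ^ j).coeff (n : ℤ)))

/-- The `p`-Cantor sequence over `ZMod p`. -/
def cantor (p : ℕ) : ℕ → ZMod p
  | 0 => 1
  | (n + 1) =>
    if hp : 1 < p then
      if (n + 1) % p % 2 = 1 then 0
      else (((p - 1) / 2).choose (((n + 1) % p) / 2) : ZMod p) * cantor p ((n + 1) / p)
    else 0
  decreasing_by exact Nat.div_lt_self (Nat.succ_pos _) hp

/-- `Θ̃_p = ∑_{i ≥ 0} c_i^{(p)} t^{-i}`. -/
def cantorTilde (p : ℕ) : LaurentSeries (ZMod p) :=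
  HahnSeries.ofPowerSeries ℤ (ZMod p) (PowerSeries.mk fun i => cantor p i)

/-- `Θ_p = t⁻¹ ∑_{i ≥ 0} c_i^{(p)} t^{-i}`. -/
def cantorTheta (p : ℕ) : LaurentSeries (ZMod p) :=
  HahnSeries.single (1 : ℤ) 1 * cantorTilde p

/-- The Thue–Morse sequence over `ZMod 2`. -/
def thueMorse (n : ℕ) : ZMod 2 := ((Nat.digits 2 n).sum : ZMod 2)

/-- The Thue–Morse Laurent series `τ = ∑_{n ≥ 1} τ_n t^{-n}`. -/
def tmSeries : LaurentSeries (ZMod 2) :=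
  HahnSeries.ofPowerSeries ℤ (ZMod 2) (PowerSeries.mk fun n => thueMorse n)

/-- The extension of a one-sided sequence to `ℤ` by zero. -/
def extendSeq (S : ℕ → K) : ℤ → K := fun i => if 0 ≤ i then S i.toNat else 0

/-- The entry `W(S)[m, n]` of the number wall of the (doubly infinite) sequence `s`:
the determinant of the `(m+1) × (m+1)` Toeplitz matrix `(s_{n - i + j})`. -/
def wallEntry (s : ℤ → K) (m : ℕ) (n : ℤ) : K :=
  (Matrix.of fun i j : Fin (m + 1) => s (n - (i : ℕ) + (j : ℕ))).det

/-- The Laurent series `t⁻¹ ∑_{i ≥ 0} s_i t^{-i}` associated to a sequence. -/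
def seriesOf (S : ℕ → K) : LaurentSeries K :=
  HahnSeries.single (1 : ℤ) 1 * HahnSeries.ofPowerSeries ℤ K (PowerSeries.mk S)

/-- The coefficient sequence of `Θ = t⁻¹ ∑ s_i t^{-i}`, extended to `ℤ` by zero. -/
def coeffSeq (f : LaurentSeries K) : ℤ → K := fun i => if 0 ≤ i then f.coeff (i + 1) else 0

/-- The absolute value of a Laurent series in `F_q((t⁻¹))`: `|f| = q^{deg f}`. -/
def absLS {K : Type*} [Field K] [Fintype K] (f : LaurentSeries K) : ℝ :=
  if f = 0 then 0 else (Fintype.card K : ℝ) ^ (-f.order)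


/-! ### Basic facts -/

lemma tLS_pow (n : ℕ) : tLS K ^ n = HahnSeries.single (-(n : ℤ)) 1 := by
  simp [tLS, HahnSeries.single_pow]

lemma tLS_ne : tLS K ≠ 0 := by simp [tLS]

lemma coeff_io (P : K[X]) (n : ℤ) :
    (aeval (tLS K) P).coeff n = if n ≤ 0 then P.coeff (-n).toNat else 0 := by
  have hc : ∀ (a : K) (m : ℕ), (algebraMap K (LaurentSeries K) a *
      (HahnSeries.single (-(m : ℤ)) (1 : K) : LaurentSeries K)).coeff n
      = if n = -(m : ℤ) then a else 0 := by
    intro a m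
    have : algebraMap K (LaurentSeries K) a = HahnSeries.C a := by
      ext n
      rw [LaurentSeries.algebraMap_apply]
    rw [this, HahnSeries.C_mul_eq_smul, HahnSeries.coeff_smul, HahnSeries.coeff_single]
    simp
  rw [aeval_def, eval₂_eq_sum_range, HahnSeries.coeff_sum]
  simp only [tLS_pow, hc]
  split_ifs with h
  · have : ∀ i : ℕ, (n = -(i : ℤ)) ↔ ((-n).toNat = i) := fun i => by omega
    simp only [this]
    rw [Finset.sum_ite_eq]
    split_ifs with h2
    · rfl
    · symm; apply coeff_eq_zero_of_natDegree_lt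
      simpa using h2
  · apply Finset.sum_eq_zero
    intro i _
    rw [if_neg (by omega)]

lemma io_inj : Function.Injective (aeval (tLS K) : K[X] → LaurentSeries K) := by
  intro P Q h
  ext n
  have := congrArg (fun f : LaurentSeries K => f.coeff (-(n : ℤ))) h
  simpa [coeff_io] using this

lemma io_ne {P : K[X]} (h : P ≠ 0) : aeval (tLS K) P ≠ 0 := by
  intro h2; apply h; apply io_inj; rw [h2, map_zero]

lemma order_io {P : K[X]} (h : P ≠ 0) : (aeval (tLS K) P).order = -(P.natDegree : ℤ) := by
  apply le_antisymm
  · apply HahnSeries.order_le_of_coeff_ne_zero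
    simpa [coeff_io] using h
  · by_contra! hlt
    have := mt HahnSeries.coeff_order_eq_zero.1 (io_ne h)
    apply this
    rw [coeff_io]
    split_ifs with h2
    · apply coeff_eq_zero_of_natDegree_lt; omega
    · rfl

lemma io_eq_zero_of_order_pos {P : K[X]} (h : 0 < (aeval (tLS K) P).order) : P = 0 := by
  by_contra hP
  rw [order_io hP] at h; omega

lemma exists_polyPart (f : LaurentSeries K) : ∃ P : K[X], polyPart f = aeval (tLS K) P := by
  refine ⟨∑ i ∈ Finset.range ((-f.order).toNat + 1), monomial i (f.coeff (-(i : ℤ))), ?_⟩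
  ext n
  rw [coeff_io]
  show (if n ≤ 0 then f.coeff n else 0) = _
  split_ifs with h
  · rw [finsetSum_coeff]
    simp only [coeff_monomial]
    rw [Finset.sum_ite_eq']
    split_ifs with h2
    · congr 1; omega
    · apply HahnSeries.coeff_eq_zero_of_lt_order
      simp at h2; omega
  · rfl

lemma order_add_ge {f g : LaurentSeries K} {n : ℤ} (hf : f = 0 ∨ n ≤ f.order)
    (hg : g = 0 ∨ n ≤ g.order) : f + g = 0 ∨ n ≤ (f + g).order := by
  rcases hf with rfl | hf
  · simpa using hg
  rcases hg with rfl | hg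
  · simp [hf]
  by_cases h : f + g = 0
  · exact Or.inl h
  · right
    exact le_trans (le_min hf hg) (HahnSeries.min_order_le_order_add h)

lemma order_add_lt {f g : LaurentSeries K} (hf : f ≠ 0) (hg : g = 0 ∨ f.order < g.order) :
    f + g ≠ 0 ∧ (f + g).order = f.order := by
  rcases hg with rfl | hg
  · simp [hf]
  have hc : (f + g).coeff f.order ≠ 0 := by
    rw [HahnSeries.coeff_add, HahnSeries.coeff_eq_zero_of_lt_order hg, add_zero]
    exact mt HahnSeries.coeff_order_eq_zero.1 hf
  have h0 : f + g ≠ 0 := by rintro h; simp [h] at hc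
  refine ⟨h0, le_antisymm (HahnSeries.order_le_of_coeff_ne_zero hc) ?_⟩
  have := HahnSeries.min_order_le_order_add h0
  rwa [min_eq_left hg.le] at this

lemma order_inv' {f : LaurentSeries K} (hf : f ≠ 0) : (f⁻¹).order = - f.order := by
  have := HahnSeries.order_mul hf (inv_ne_zero hf)
  rw [mul_inv_cancel₀ hf, HahnSeries.order_one] at this
  omega

lemma order_frac_pos {f : LaurentSeries K} (h : f - polyPart f ≠ 0) :
    0 < (f - polyPart f).order := by
  by_contra! hlt
  apply mt HahnSeries.coeff_order_eq_zero.1 h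
  rw [HahnSeries.coeff_sub]
  show _ - (if _ then _ else _) = _
  rw [if_pos hlt, sub_self]

lemma order_polyPart {f : LaurentSeries K} (h : f ≠ 0) (h2 : f.order ≤ 0) :
    polyPart f ≠ 0 ∧ (polyPart f).order = f.order := by
  have hc : (polyPart f).coeff f.order ≠ 0 := by
    show (if _ then _ else _) ≠ _
    rw [if_pos h2]
    exact mt HahnSeries.coeff_order_eq_zero.1 h
  have h0 : polyPart f ≠ 0 := by rintro h; simp [h] at hc
  refine ⟨h0, le_antisymm (HahnSeries.order_le_of_coeff_ne_zero hc) ?_⟩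
  by_contra! hlt
  apply mt HahnSeries.coeff_order_eq_zero.1 h0
  show (if _ then f.coeff _ else _) = _
  rw [HahnSeries.coeff_eq_zero_of_lt_order hlt]; simp

/-- irrationality in elementary form -/
def Irr (f : LaurentSeries K) : Prop :=
  ∀ U V : K[X], V ≠ 0 → aeval (tLS K) V * f - aeval (tLS K) U ≠ 0

lemma convergents (f : LaurentSeries K) (hf : Irr f) (i : ℕ) :
    ∃ U V U' V' : K[X], V ≠ 0 ∧ IsCoprime U V ∧
      (∃ e : K[X], (e = 1 ∨ e = -1) ∧ U * V' - U' * V = e) ∧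
      (V' = 0 ∨ V'.natDegree < V.natDegree) ∧
      (cfQuot f (i+1) ≠ 0 ∧ (cfQuot f (i+1)).order < 0) ∧
      (aeval (tLS K) V' * f - aeval (tLS K) U') +
        cfQuot f (i+1) * (aeval (tLS K) V * f - aeval (tLS K) U) = 0 ∧
      (aeval (tLS K) V).order + (aeval (tLS K) V' * f - aeval (tLS K) U').order = 0 := by
  induction i with
  | zero =>
    obtain ⟨A, hA⟩ := exists_polyPart f
    have h1 := hf A 1 one_ne_zero
    rw [map_one, one_mul, ← hA] at h1
    refine ⟨A, 1, 1, 0, one_ne_zero, isCoprime_one_right, ⟨-1, Or.inr rfl, by ring⟩, Or.inl rfl,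
      ?_, ?_, ?_⟩
    · simp only [cfQuot]
      refine ⟨inv_ne_zero h1, ?_⟩
      rw [order_inv' h1]
      have := order_frac_pos h1
      omega
    · simp only [cfQuot, map_one, map_zero, one_mul, zero_mul, ← hA]
      rw [inv_mul_cancel₀ h1]; ring
    · simp [HahnSeries.order_neg]
  | succ i ih =>
    obtain ⟨U, V, U', V', hV, -, ⟨e, he, hdet⟩, hdeg, ⟨hq0, hq⟩, hrec, hord⟩ := ih
    set θ := cfQuot f (i+1) with hθ
    obtain ⟨A, hA⟩ := exists_polyPart θ
    obtain ⟨hp0, hp⟩ := order_polyPart hq0 hq.le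
    rw [hA] at hp0 hp
    have hA0 : A ≠ 0 := by rintro rfl; simp at hp0
    rw [order_io hA0] at hp
    have hVd : A * V + V' ≠ 0 ∧ (A * V + V').natDegree = A.natDegree + V.natDegree := by
      have hm : (A * V).natDegree = A.natDegree + V.natDegree := natDegree_mul hA0 hV
      rcases hdeg with rfl | hdeg
      · simp [hA0, hV, hm]
      · have : (A * V + V').natDegree = A.natDegree + V.natDegree := by
          rw [natDegree_add_eq_left_of_natDegree_lt (by omega), hm]
        refine ⟨?_, this⟩
        rintro h0
        rw [h0, natDegree_zero] at this
        omega
    obtain ⟨hV0, hVd⟩ := hVd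
    have hdet2 : (A * U + U') * V - U * (A * V + V') = -e := by linear_combination -hdet
    have hR := hf U V hV
    set R := aeval (tLS K) V * f - aeval (tLS K) U with hRdef
    have hR2 := hf (A * U + U') (A * V + V') hV0
    have hRR : aeval (tLS K) (A * V + V') * f - aeval (tLS K) (A * U + U')
        = -((θ - polyPart θ) * R) := by
      rw [hA]; simp only [map_add, map_mul]; rw [hRdef] at hrec ⊢; linear_combination hrec
    have hfr : θ - polyPart θ ≠ 0 := by
      rintro h; rw [hRR, h] at hR2; simp at hR2
    have hq' : cfQuot f (i+1+1) = (θ - polyPart θ)⁻¹ := rfl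
    refine ⟨A * U + U', A * V + V', U, V, hV0, ?_, ⟨-e, ?_, hdet2⟩, Or.inr ?_, ⟨?_, ?_⟩, ?_, ?_⟩
    · rcases he with rfl | rfl
      · exact ⟨-V, U, by linear_combination -hdet2⟩
      · exact ⟨V, -U, by linear_combination hdet2⟩
    · rcases he with rfl | rfl <;> simp
    · omega
    · rw [hq']; exact inv_ne_zero hfr
    · rw [hq', order_inv' hfr]
      have := order_frac_pos hfr
      omega
    · rw [hRR, hq']
      field_simp
      ring
    · rw [order_io hV0, hVd]
      rw [order_io hV] at hord
      have : (aeval (tLS K) V' * f - aeval (tLS K) U') = -(θ * R) := by linear_combination hrec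
      rw [this, HahnSeries.order_neg, HahnSeries.order_mul hq0 hR] at hord
      rw [← hRdef]
      push_cast
      omega

lemma pq_bound (f : LaurentSeries K) (hf : Irr f) (h : ℤ)
    (H : ∀ U V : K[X], V ≠ 0 → IsCoprime U V →
      0 < (aeval (tLS K) V).order + (aeval (tLS K) V * f - aeval (tLS K) U).order →
      h ≤ (aeval (tLS K) V).order + (aeval (tLS K) V * f - aeval (tLS K) U).order)
    (i : ℕ) (hi : 1 ≤ i) : h ≤ degZ (cfPQ f i) ∧ 0 < degZ (cfPQ f i) := by
  obtain ⟨i, rfl⟩ : ∃ k, i = k + 1 := ⟨i - 1, by omega⟩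
  obtain ⟨U, V, U', V', hV, hcop, -, -, ⟨hq0, hq⟩, hrec, hord⟩ := convergents f hf i
  obtain ⟨hp0, hp⟩ := order_polyPart hq0 hq.le
  have hR := hf U V hV
  have hd : degZ (cfPQ f (i+1)) = -(cfQuot f (i+1)).order := by rw [degZ, cfPQ, hp]
  have : (aeval (tLS K) V' * f - aeval (tLS K) U') =
    -(cfQuot f (i+1) * (aeval (tLS K) V * f - aeval (tLS K) U)) := by linear_combination hrec
  rw [this, HahnSeries.order_neg, HahnSeries.order_mul hq0 hR] at hord
  have := H U V hV hcop (by omega)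
  omega

/-! ### Decomposition along `q`-th powers -/

lemma exists_dom {s : Finset ℕ} {x : ℕ → LaurentSeries K} (h : ∑ i ∈ s, x i ≠ 0) :
    ∃ i ∈ s, x i ≠ 0 ∧ (x i).order ≤ (∑ i ∈ s, x i).order := by
  have hc := mt HahnSeries.coeff_order_eq_zero.1 h
  rw [HahnSeries.coeff_sum] at hc
  obtain ⟨i, hi, hne⟩ := Finset.exists_ne_zero_of_sum_ne_zero hc
  refine ⟨i, hi, ?_, HahnSeries.order_le_of_coeff_ne_zero hne⟩
  rintro h0; simp [h0] at hne

lemma sep {w : LaurentSeries K} (hw : w ≠ 0) (hwo : w.order = -1) {q : ℕ}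
    (f : ℕ → LaurentSeries K) {i : ℕ} (hi : i < q) (hfi : f i ≠ 0) :
    (∑ i ∈ Finset.range q, w ^ i * f i ^ q) ≠ 0 ∧
    (∑ i ∈ Finset.range q, w ^ i * f i ^ q).order ≤ (w ^ i * f i ^ q).order := by
  have hord : ∀ i, f i ≠ 0 → (w ^ i * f i ^ q).order = q * (f i).order - i := by
    intro i hi
    rw [HahnSeries.order_mul (pow_ne_zero _ hw) (pow_ne_zero _ hi), HahnSeries.order_pow,
      HahnSeries.order_pow, hwo]
    simp; ring
  set s := (Finset.range q).filter (fun i => f i ≠ 0) with hs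
  have hne : s.Nonempty := ⟨i, by simp [hs, hi, hfi]⟩
  obtain ⟨m, hm, hmin⟩ := s.exists_min_image (fun i => (w ^ i * f i ^ q).order) hne
  simp only [hs, Finset.mem_filter, Finset.mem_range] at hm hmin
  have hc : (∑ i ∈ Finset.range q, w ^ i * f i ^ q).coeff (w ^ m * f m ^ q).order ≠ 0 := by
    rw [HahnSeries.coeff_sum, Finset.sum_eq_single m]
    · exact mt HahnSeries.coeff_order_eq_zero.1
        (mul_ne_zero (pow_ne_zero _ hw) (pow_ne_zero _ hm.2))
    · intro b hb hbm
      by_cases hfb : f b = 0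
      · rw [hfb, zero_pow (by omega)]; simp
      apply HahnSeries.coeff_eq_zero_of_lt_order
      refine lt_of_le_of_ne (hmin b ⟨by simpa using hb, hfb⟩) ?_
      rw [hord _ hfb, hord _ hm.2]
      intro he
      apply hbm
      have hb' : b < q := by simpa using hb
      have hm' := hm.1
      have hdvd : (q : ℤ) ∣ (b : ℤ) - m :=
        ⟨(f b).order - (f m).order, by linear_combination he⟩
      have := Int.eq_zero_of_abs_lt_dvd hdvd (by rw [abs_lt]; constructor <;> omega)
      omega
    · intro h; simp [hm.1] at h
  refine ⟨?_, (HahnSeries.order_le_of_coeff_ne_zero hc).trans (hmin i ⟨hi, hfi⟩)⟩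
  rintro h0; simp [h0] at hc

lemma decomp (p : ℕ) [Fact p.Prime] (k : ℕ) (V : (ZMod p)[X]) :
    ∃ v : ℕ → (ZMod p)[X], V = ∑ i ∈ Finset.range (p ^ k), (X + 1) ^ i * v i ^ (p ^ k) := by
  have hq : 0 < p ^ k := pow_pos (Fact.out : p.Prime).pos k
  rw [← sum_taylor_eq V (-1)]
  unfold Polynomial.sum
  generalize (taylor (-1) V) = W
  induction W.support using Finset.induction_on with
  | empty => exact ⟨0, by simp [zero_pow hq.ne']⟩
  | insert n s hn ih =>
    obtain ⟨v, hv⟩ := ih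
    refine ⟨v + Pi.single (n % p ^ k) (C (W.coeff n) * (X + 1) ^ (n / p ^ k)), ?_⟩
    rw [Finset.sum_insert hn, hv]
    simp only [Pi.add_apply, add_pow_char_pow, mul_add, Finset.sum_add_distrib]
    rw [add_comm]
    congr 1
    rw [Finset.sum_eq_single (n % p ^ k)]
    · rw [Pi.single_eq_same, mul_pow, ← C_pow, ZMod.pow_card_pow, ← pow_mul]
      rw [mul_left_comm, ← pow_add, C_neg, C_1, sub_neg_eq_add, mul_comm (n / p ^ k),
        Nat.mod_add_div]
    · intro b _ hb
      rw [Pi.single_eq_of_ne hb, zero_pow hq.ne', mul_zero]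
    · intro h
      exact absurd (Finset.mem_range.2 (Nat.mod_lt _ hq)) h

lemma X1_ne {p : ℕ} [Fact p.Prime] : (X + 1 : (ZMod p)[X]) ≠ 0 := by
  have := (monic_X_add_C (1 : ZMod p)).ne_zero
  simpa using this

lemma X1_deg {p : ℕ} [Fact p.Prime] : (X + 1 : (ZMod p)[X]).natDegree = 1 := by
  have := natDegree_X_add_C (1 : ZMod p)
  simpa using this

instance charLS (p : ℕ) [Fact p.Prime] : CharP (LaurentSeries (ZMod p)) p :=
  charP_of_injective_algebraMap (algebraMap (ZMod p) (LaurentSeries (ZMod p))).injective p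

lemma key (p : ℕ) [Fact p.Prime] (k h : ℕ) (hq : p ^ k = 2 * h + 1)
    (B g : LaurentSeries (ZMod p)) (hB : B = aeval (tLS (ZMod p)) (X + 1 : (ZMod p)[X]) ^ h * g ^ (p ^ k))
    (hirr : Irr B) (U V : (ZMod p)[X]) (hV : V ≠ 0) (hcop : IsCoprime U V)
    (hpos : 0 < (aeval (tLS (ZMod p)) V).order
      + (aeval (tLS (ZMod p)) V * B - aeval (tLS (ZMod p)) U).order) :
    (h : ℤ) ≤ (aeval (tLS (ZMod p)) V).order
      + (aeval (tLS (ZMod p)) V * B - aeval (tLS (ZMod p)) U).order := by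
  set q := p ^ k with hqdef
  set io := aeval (R := ZMod p) (tLS (ZMod p)) with hio
  obtain ⟨v, hv⟩ := decomp p k V
  obtain ⟨u, hu⟩ := decomp p k U
  rw [← hqdef] at hv hu
  set w := io (X + 1) with hw
  have hw0 : w ≠ 0 := io_ne X1_ne
  have hwo : w.order = -1 := by rw [hw, hio, order_io X1_ne, X1_deg]; rfl
  have hIV : io V = ∑ i ∈ Finset.range q, w ^ i * (io (v i)) ^ q := by
    conv_lhs => rw [hv]
    simp [hw]
  have hIU : io U = ∑ i ∈ Finset.range q, w ^ i * (io (u i)) ^ q := by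
    conv_lhs => rw [hu]
    simp [hw]
  have hsub : ∀ a b : LaurentSeries (ZMod p), (a - b) ^ q = a ^ q - b ^ q := fun a b => by
    rw [hqdef, sub_pow_char_pow]
  -- components of the error
  set f : ℕ → LaurentSeries (ZMod p) := fun r =>
    if h ≤ r then io (v (r - h)) * g - io (u r) else w * io (v (r + h + 1)) * g - io (u r) with hf
  -- index map
  have hcomp : ∀ i < q, ∃ r < q, ((i + h = r) ∨ (i = r + h + 1)) ∧
      io ((X + 1) ^ i * v i ^ q) * B - io ((X + 1) ^ r * u r ^ q) = w ^ r * f r ^ q := by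
    intro i hi
    by_cases hih : i ≤ h
    · refine ⟨i + h, by omega, Or.inl rfl, ?_⟩
      simp only [hf]
      rw [if_pos (by omega), hsub, Nat.add_sub_cancel, hB]
      simp only [map_mul, map_pow, ← hw]
      ring
    · obtain ⟨r, rfl⟩ : ∃ r, i = r + h + 1 := ⟨i - h - 1, by omega⟩
      refine ⟨r, by omega, Or.inr rfl, ?_⟩
      simp only [hf]
      rw [if_neg (by omega), hsub, hB]
      simp only [map_mul, map_pow, ← hw]
      have : w ^ (r + h + 1) * w ^ h = w ^ r * w ^ q := by
        rw [hq]; ring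
      linear_combination (io (v (r+h+1)))^q * g ^ q * this
  have herr : io V * B - io U = ∑ r ∈ Finset.range q, w ^ r * f r ^ q := by
    have e1 : ∑ r ∈ Finset.range q, w ^ r * f r ^ q =
      ∑ r ∈ Finset.range q, (if h ≤ r then w ^ r * (io (v (r - h)) * g) ^ q
        else w ^ r * (w * io (v (r + h + 1)) * g) ^ q)
      - ∑ r ∈ Finset.range q, w ^ r * io (u r) ^ q := by
      rw [← Finset.sum_sub_distrib]
      apply Finset.sum_congr rfl
      intro r _
      simp only [hf]
      split_ifs <;> rw [hsub] <;> ring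
    rw [e1, ← hIU, hIV, Finset.sum_mul]
    congr 1
    have hqq : q = h + (h + 1) := by omega
    have hqq' : q = (h + 1) + h := by omega
    conv_lhs => rw [hqq', Finset.sum_range_add]
    conv_rhs => rw [hqq, Finset.sum_range_add]
    rw [add_comm, ← hqq, ← hqq']
    congr 1
    · apply Finset.sum_congr rfl
      intro r hr
      rw [if_neg (by simpa using hr), hB]
      have : w ^ (h + 1 + r) * w ^ h = w ^ r * w ^ q := by
        rw [hq]; ring
      rw [show r + h + 1 = h + 1 + r by ring]
      linear_combination (io (v (h+1+r)))^q * g ^ q * this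
    · apply Finset.sum_congr rfl
      intro r hr
      rw [if_pos (by omega), hB, Nat.add_sub_cancel_left]
      ring
  -- the dominating component of V
  have hIV0 : io V ≠ 0 := io_ne hV
  obtain ⟨i, hi, hvi0, hvio⟩ := exists_dom (hIV ▸ hIV0)
  rw [← hIV] at hvio
  rw [Finset.mem_range] at hi
  have hq0 : q ≠ 0 := by omega
  have hvi : io (v i) ≠ 0 := by
    rintro h0; rw [h0, zero_pow hq0, mul_zero] at hvi0; exact hvi0 rfl
  have hle := (sep hw0 hwo (fun i => io (v i)) hi hvi).2
  simp only [← hIV] at hle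
  have hVV : (io V).order = (w ^ i * io (v i) ^ q).order := le_antisymm hle hvio
  obtain ⟨r, hr, hir, hcr⟩ := hcomp i hi
  have hvp : v i ≠ 0 := by rintro h0; rw [h0, map_zero] at hvi; exact hvi rfl
  have hV'0 : (X + 1) ^ i * v i ^ q ≠ 0 := mul_ne_zero (pow_ne_zero _ X1_ne) (pow_ne_zero _ hvp)
  have hIV' : io ((X + 1) ^ i * v i ^ q) = w ^ i * io (v i) ^ q := by simp [hw]
  have hVV' : (io V).order = (io ((X + 1) ^ i * v i ^ q)).order := by rw [hIV', hVV]
  have herr' := hirr ((X + 1) ^ r * u r ^ q) ((X + 1) ^ i * v i ^ q) hV'0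
  rw [← hio, hcr] at herr'
  have hfr : f r ≠ 0 := by
    rintro h0; rw [h0, zero_pow hq0, mul_zero] at herr'; exact herr' rfl
  have hle2 := (sep hw0 hwo f hr hfr).2
  rw [← herr, ← hcr] at hle2
  rw [← hcr] at herr'
  have herr0 := hirr U V hV
  rw [← hio] at herr0
  set V' := (X + 1) ^ i * v i ^ q with hV'
  set U' := (X + 1) ^ r * u r ^ q with hU'
  set R := io V * B - io U with hR
  set R' := io V' * B - io U' with hR'
  have hVU : V * U' - U * V' = 0 := by
    have e : io (V * U' - U * V') = io V' * R + -(io V * R') := by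
      simp only [map_sub, map_mul, hR, hR']; ring
    have hA : (io V' * R).order = (io V').order + R.order :=
      HahnSeries.order_mul (io_ne hV'0) herr0
    have hB : (-(io V * R')).order = (io V).order + R'.order := by
      rw [HahnSeries.order_neg, HahnSeries.order_mul hIV0 herr']
    have := order_add_ge (f := io V' * R) (g := -(io V * R')) (n := 1)
      (Or.inr (by omega)) (Or.inr (by omega))
    rw [← e] at this
    rcases this with h0 | h0
    · apply io_inj; rw [map_zero]; exact h0
    · exact io_eq_zero_of_order_pos (by rw [← hio]; omega)
  have hdvd : V ∣ V' := by
    have : V ∣ U * V' := ⟨U', by linear_combination -hVU⟩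
    exact hcop.symm.dvd_of_dvd_mul_left this
  obtain ⟨c, hc⟩ := hdvd
  have hc0 : c ≠ 0 := by rintro rfl; rw [mul_zero] at hc; exact hV'0 hc
  have hUc : U' = U * c := by
    apply mul_left_cancel₀ hV
    rw [hc] at hVU; linear_combination hVU
  have hcd : c.natDegree = 0 := by
    rw [hio, order_io hV, order_io hV'0, hc, natDegree_mul hV hc0] at hVV'
    push_cast at hVV'; omega
  have hcu : IsUnit c := by
    rw [Polynomial.isUnit_iff_degree_eq_zero, degree_eq_natDegree hc0, hcd]; rfl
  have hRR : R' = io c * R := by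
    rw [hR', hR, hc, hUc]; simp only [map_mul]; ring
  have hRo : R'.order = R.order := by
    rw [hRR, HahnSeries.order_mul (io_ne hc0) herr0, order_io hc0, hcd]; simp
  have hcop' : IsCoprime U' V' := by
    rw [hUc, hc]
    exact (isCoprime_mul_unit_right hcu U V).2 hcop
  have hir0 : r = 0 ∨ i = 0 := by
    by_contra! hcon
    have d1 : (X + 1 : (ZMod p)[X]) ∣ U' := Dvd.dvd.mul_right (dvd_pow_self _ hcon.1) _
    have d2 : (X + 1 : (ZMod p)[X]) ∣ V' := Dvd.dvd.mul_right (dvd_pow_self _ hcon.2) _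
    have := natDegree_eq_zero_of_isUnit (hcop'.isUnit_of_dvd' d1 d2)
    rw [X1_deg] at this; omega
  have o1 : (io V).order = q * (io (v i)).order - i := by
    rw [hVV, HahnSeries.order_mul (pow_ne_zero _ hw0) (pow_ne_zero _ hvi), HahnSeries.order_pow,
      HahnSeries.order_pow, hwo]
    simp; ring
  have o2 : R.order = q * (f r).order - r := by
    rw [← hRo, hcr, HahnSeries.order_mul (pow_ne_zero _ hw0) (pow_ne_zero _ hfr),
      HahnSeries.order_pow, HahnSeries.order_pow, hwo]
    simp; ring
  have hsum : (io V).order + R.order = q * ((io (v i)).order + (f r).order) - (i + r) := by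
    rw [o1, o2]; ring
  have hir2 : i + r ≤ h + 1 := by omega
  have hs : 0 < (io (v i)).order + (f r).order := by
    by_contra! hneg
    have : (q : ℤ) * ((io (v i)).order + (f r).order) ≤ 0 :=
      mul_nonpos_of_nonneg_of_nonpos (by positivity) hneg
    omega
  have : (q : ℤ) * 1 ≤ q * ((io (v i)).order + (f r).order) :=
    mul_le_mul_of_nonneg_left hs (by positivity)
  omega

/-! ### Periodicity -/

lemma periodic [Finite K] (f S : LaurentSeries K) (D Q₀ : K[X]) (σ : ℕ)
    (hS : S ^ 2 = aeval (tLS K) D) (hSo : -(σ : ℤ) ≤ S.order)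
    (hirr : Irr f) (hQ₀ : Q₀ ≠ 0) (hQd : Q₀.natDegree ≤ σ) (hf : aeval (tLS K) Q₀ * f = S)
    (hdvd : Q₀ ∣ D) : ∃ s : ℕ × ℕ, PeriodWindow f s.1 s.2 := by
  have inv : ∀ i, ∃ P Q : K[X], Q ≠ 0 ∧ Q.natDegree ≤ σ ∧ P.natDegree ≤ σ ∧ Q ∣ D - P ^ 2 ∧
      aeval (tLS K) Q * cfQuot f i = aeval (tLS K) P + S := by
    intro i
    induction i with
    | zero => exact ⟨0, Q₀, hQ₀, hQd, by simp, by simpa using hdvd, by simpa [cfQuot] using hf⟩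
    | succ i ih =>
      obtain ⟨P, Q, hQ, hQs, hPs, hd, he⟩ := ih
      obtain ⟨-, -, -, -, -, -, -, -, ⟨hq0, -⟩, -, -⟩ := convergents f hirr i
      have hq' : cfQuot f (i+1) = (cfQuot f i - polyPart (cfQuot f i))⁻¹ := rfl
      set θ := cfQuot f i with hθ
      have hfr : θ - polyPart θ ≠ 0 := by
        rintro h; rw [hq', h, inv_zero] at hq0; exact hq0 rfl
      have hfo := order_frac_pos hfr
      obtain ⟨A, hA⟩ := exists_polyPart θ
      have hd' : Q ∣ D - (A * Q - P) ^ 2 := by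
        have : D - (A * Q - P) ^ 2 = (D - P ^ 2) + Q * (-(A ^ 2 * Q) + 2 * A * P) := by ring
        rw [this]; exact dvd_add hd (dvd_mul_right _ _)
      obtain ⟨Q', hQ'⟩ := hd'
      set P' := A * Q - P with hP'
      have e1 : S - aeval (tLS K) P' = aeval (tLS K) Q * (θ - polyPart θ) := by
        rw [hA, hP']; simp only [map_sub, map_mul]; linear_combination -he
      have e1n : S - aeval (tLS K) P' ≠ 0 := by rw [e1]; exact mul_ne_zero (io_ne hQ) hfr
      have e1o : (S - aeval (tLS K) P').order = -(Q.natDegree : ℤ) + (θ - polyPart θ).order := by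
        rw [e1, HahnSeries.order_mul (io_ne hQ) hfr, order_io hQ]
      have e2n : S + aeval (tLS K) P' ≠ 0 := by
        have := hirr (-P') Q₀ hQ₀
        rwa [hf, map_neg, sub_neg_eq_add] at this
      have hP'o : aeval (tLS K) P' = 0 ∨ -(σ : ℤ) ≤ (aeval (tLS K) P').order := by
        have := order_add_ge (f := S) (g := -(S - aeval (tLS K) P')) (n := -(σ : ℤ))
          (Or.inr hSo) (Or.inr (by rw [HahnSeries.order_neg]; omega))
        rwa [show S + -(S - aeval (tLS K) P') = aeval (tLS K) P' by ring] at this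
      have hP's : P'.natDegree ≤ σ := by
        by_cases h0 : P' = 0
        · simp [h0]
        · rcases hP'o with h | h
          · exact absurd h (io_ne h0)
          · rw [order_io h0] at h; omega
      have e2o : -(σ : ℤ) ≤ (S + aeval (tLS K) P').order :=
        (order_add_ge (Or.inr hSo) hP'o).resolve_left e2n
      have e3 : aeval (tLS K) Q * aeval (tLS K) Q' =
          (S - aeval (tLS K) P') * (S + aeval (tLS K) P') := by
        rw [← map_mul, ← hQ', map_sub, map_pow, ← hS]; ring
      have hQ'0 : Q' ≠ 0 := by
        rintro rfl
        rw [map_zero, mul_zero] at e3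
        exact mul_ne_zero e1n e2n e3.symm
      refine ⟨P', Q', hQ'0, ?_, hP's, ⟨Q, by rw [hQ']; ring⟩, ?_⟩
      · have := congrArg HahnSeries.order e3
        rw [HahnSeries.order_mul (io_ne hQ) (io_ne hQ'0), HahnSeries.order_mul e1n e2n,
          order_io hQ, order_io hQ'0, e1o] at this
        omega
      · rw [hq']
        have hQi := io_ne hQ
        rw [← div_eq_mul_inv, div_eq_iff hfr]
        apply mul_left_cancel₀ hQi
        rw [e3, e1]; ring
  have hfinP : {P : K[X] | P.natDegree ≤ σ}.Finite := by
    have hfin : Finite (degreeLT K (σ + 1)) :=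
      Finite.of_equiv _ (degreeLTEquiv K (σ + 1)).toEquiv.symm
    refine Set.Finite.subset (s := (degreeLT K (σ + 1) : Set K[X])) (Set.toFinite _) ?_
    intro P hP
    simp only [SetLike.mem_coe, mem_degreeLT]
    refine lt_of_le_of_lt degree_le_natDegree ?_
    have hP' : P.natDegree < σ + 1 := Nat.lt_succ_of_le hP
    exact_mod_cast hP'
  have hfin : (Set.range (cfQuot f)).Finite := by
    refine ((hfinP.prod hfinP).image
      (fun z : K[X] × K[X] => (aeval (tLS K) z.1 + S) / aeval (tLS K) z.2)).subset ?_
    rintro _ ⟨i, rfl⟩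
    obtain ⟨P, Q, hQ, hQs, hPs, -, he⟩ := inv i
    refine ⟨(P, Q), ⟨hPs, hQs⟩, ?_⟩
    simp only
    rw [← he, mul_div_cancel_left₀ _ (io_ne hQ)]
  have : Finite (Set.range (cfQuot f)) := hfin
  obtain ⟨a, b, hab, he⟩ := Finite.exists_ne_map_eq_of_infinite (Set.rangeFactorization (cfQuot f))
  replace he : cfQuot f a = cfQuot f b := congrArg Subtype.val he
  wlog hlt : a < b generalizing a b
  · exact this b a hab.symm he.symm (by omega)
  have hstep : ∀ r, cfQuot f (a + r) = cfQuot f (b + r) := by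
    intro r
    induction r with
    | zero => exact he
    | succ r ih => rw [← add_assoc, ← add_assoc]; simp only [cfQuot]; rw [ih]
  refine ⟨(a, b - a), by simp; omega, ?_⟩
  intro i hi
  simp only at hi ⊢
  rw [cfPQ, cfPQ]
  have := hstep (i - a)
  rw [show a + (i - a) = i by omega, show b + (i - a) = i + (b - a) by omega] at this
  rw [this]

/-! ### Doubling -/

/-- substitution `X ↦ X^2` -/
def dbl (K : Type*) [Field K] : LaurentSeries K →+* LaurentSeries K :=
  HahnSeries.embDomainRingHom (AddMonoidHom.mulLeft (2 : ℤ))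
    (fun a b h => by simpa using h) (fun a b => by simp)

lemma dbl_coeff_even (f : LaurentSeries K) (n : ℤ) : (dbl K f).coeff (2 * n) = f.coeff n := by
  exact HahnSeries.embDomain_coeff
    (f := ⟨⟨AddMonoidHom.mulLeft (2 : ℤ), fun a b h => by simpa using h⟩, by simp⟩) (a := n)

lemma dbl_coeff_odd (f : LaurentSeries K) (n : ℤ) (hn : Odd n) : (dbl K f).coeff n = 0 := by
  apply HahnSeries.embDomain_of_notMem_range
  rintro ⟨m, hm⟩
  have : 2 * m = n := hm
  have := hn
  rw [Int.odd_iff] at this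
  omega

lemma dbl_polyPart (f : LaurentSeries K) : dbl K (polyPart f) = polyPart (dbl K f) := by
  ext n
  show _ = if _ then _ else _
  rcases Int.even_or_odd' n with ⟨m, rfl | rfl⟩
  · rw [dbl_coeff_even, dbl_coeff_even]
    show (if _ then _ else _) = _
    congr 1
    simp only [eq_iff_iff]; omega
  · have : Odd (2 * m + 1) := ⟨m, rfl⟩
    rw [dbl_coeff_odd _ _ this, dbl_coeff_odd _ _ this]; simp

lemma dbl_cfQuot (f : LaurentSeries K) (i : ℕ) : cfQuot (dbl K f) i = dbl K (cfQuot f i) := by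
  induction i with
  | zero => rfl
  | succ i ih => simp only [cfQuot]; rw [ih, ← dbl_polyPart, ← map_sub, map_inv₀]

lemma dbl_cfPQ (f : LaurentSeries K) (i : ℕ) : cfPQ (dbl K f) i = dbl K (cfPQ f i) := by
  rw [cfPQ, dbl_cfQuot, ← dbl_polyPart]; rfl

lemma dbl_order (f : LaurentSeries K) : (dbl K f).order = 2 * f.order := by
  by_cases h : f = 0
  · simp [h]
  have h' : dbl K f ≠ 0 := (_root_.map_ne_zero (dbl K)).2 h
  apply le_antisymm
  · apply HahnSeries.order_le_of_coeff_ne_zero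
    rw [dbl_coeff_even]; exact mt HahnSeries.coeff_order_eq_zero.1 h
  · have hc := mt HahnSeries.coeff_order_eq_zero.1 h'
    rcases Int.even_or_odd' (dbl K f).order with ⟨m, hm | hm⟩
    · rw [hm, dbl_coeff_even] at hc
      have := HahnSeries.order_le_of_coeff_ne_zero hc
      omega
    · exact absurd (dbl_coeff_odd _ _ ⟨m, hm⟩) hc

lemma dbl_t (n : ℕ) : dbl K (tLS K ^ n) = tLS K ^ (2 * n) := by
  rw [tLS_pow, tLS_pow]
  ext m
  rcases Int.even_or_odd' m with ⟨m, rfl | rfl⟩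
  · rw [dbl_coeff_even, HahnSeries.coeff_single, HahnSeries.coeff_single]
    congr 1
    push_cast; simp only [eq_iff_iff]; omega
  · rw [dbl_coeff_odd _ _ ⟨m, rfl⟩, HahnSeries.coeff_single, if_neg (by push_cast; omega)]

/-! ### Mass estimate -/

lemma eMassOf_bound (f : LaurentSeries K) (h : ∃ s : ℕ × ℕ, PeriodWindow f s.1 s.2)
    (c : ℤ) (hc : 0 < c) (hd : ∀ i, 1 ≤ i → c ≤ degZ (cfPQ f i)) (n : ℕ) :
    1 - (n : ℝ) / c ≤ eMassOf f n ∧ eMassOf f n ≤ 1 := by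
  rw [eMassOf, dif_pos h]
  have hw := Classical.choose_spec h
  generalize Classical.choose h = s at hw
  obtain ⟨m, l⟩ := s
  simp only at hw ⊢
  have hl := hw.1
  have hcR : (0 : ℝ) < c := by exact_mod_cast hc
  have hdi : ∀ i ∈ Finset.Ico (m + 1) (m + 1 + l), (c : ℝ) ≤ (degZ (cfPQ f i) : ℝ) := by
    intro i hi
    rw [Finset.mem_Ico] at hi
    exact_mod_cast hd i (by omega)
  have hpos : 0 < ∑ i ∈ Finset.Ico (m + 1) (m + 1 + l), (degZ (cfPQ f i) : ℝ) := by
    apply Finset.sum_pos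
    · intro i hi; exact lt_of_lt_of_le hcR (hdi i hi)
    · rw [Finset.nonempty_Ico]; omega
  constructor
  · rw [le_div_iff₀ hpos, Finset.mul_sum]
    apply Finset.sum_le_sum
    intro i hi
    refine le_trans ?_ (le_max_left _ _)
    have h1 := hdi i hi
    have : (n : ℝ) ≤ n / c * (degZ (cfPQ f i) : ℝ) := by
      rw [div_mul_eq_mul_div, le_div_iff₀ hcR]
      exact mul_le_mul_of_nonneg_left h1 (by positivity)
    linarith
  · rw [div_le_one hpos]
    apply Finset.sum_le_sum
    intro i hi
    have h1 := hdi i hi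
    apply max_le
    · have : (0 : ℝ) ≤ n := by positivity
      linarith
    · linarith

/-! ### The Cantor series -/

lemma cantor_rec (p : ℕ) (hp : 1 < p) (n : ℕ) : cantor p n =
    if n % p % 2 = 1 then 0
    else (((p - 1) / 2).choose ((n % p) / 2) : ZMod p) * cantor p (n / p) := by
  cases n with
  | zero => simp [cantor]
  | succ n => rw [cantor, dif_pos hp]

lemma cantor_odd (p : ℕ) (hp : 1 < p) (hodd : Odd p) (n : ℕ) (hn : Odd n) : cantor p n = 0 := by
  induction n using Nat.strong_induction_on with
  | _ n ih =>
    rw [cantor_rec p hp]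
    split_ifs with h
    · rfl
    · have hn0 : 0 < n := hn.pos
      rw [ih (n / p) (Nat.div_lt_self hn0 hp), mul_zero]
      have h2 : Even (n % p) := by rw [Nat.even_iff]; omega
      by_contra h3
      rw [Nat.not_odd_iff_even] at h3
      have : Even (n % p + p * (n / p)) := h2.add (h3.mul_left p)
      rw [Nat.mod_add_div] at this
      exact (Nat.not_even_iff_odd.2 hn) this

lemma cantor_even (p : ℕ) (hp : 1 < p) (hodd : Odd p) (n : ℕ) : cantor p (2 * n) =
    (((p - 1) / 2).choose (n % p) : ZMod p) * cantor p (2 * (n / p)) := by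
  obtain ⟨h, rfl⟩ := hodd
  set p := 2 * h + 1 with hpdef
  have hh : (p - 1) / 2 = h := by omega
  rw [cantor_rec p hp, hh]
  have hm : n % p < p := Nat.mod_lt _ (by omega)
  have hdm := Nat.mod_add_div n p
  set r := n % p
  set m := n / p
  by_cases hr : r ≤ h
  · have e : 2 * n = 2 * r + p * (2 * m) := by rw [← hdm]; ring
    have e1 : 2 * n % p = 2 * r := by
      rw [e, Nat.add_mul_mod_self_left, Nat.mod_eq_of_lt (by omega)]
    have e2 : 2 * n / p = 2 * m := by
      rw [e, Nat.add_mul_div_left _ _ (by omega), Nat.div_eq_of_lt (by omega), zero_add]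
    rw [e1, e2, if_neg (by omega), Nat.mul_div_cancel_left _ (by norm_num)]
  · have e : 2 * n = (2 * r - p) + p * (2 * m + 1) := by
      have : 2 * n = 2 * r + p * (2 * m) := by rw [← hdm]; ring
      rw [this, mul_add]; omega
    have e1 : 2 * n % p = 2 * r - p := by
      rw [e, Nat.add_mul_mod_self_left, Nat.mod_eq_of_lt (by omega)]
    rw [e1, if_pos (by omega), Nat.choose_eq_zero_of_lt (by omega)]
    simp

/-- the even part of the Cantor series -/
def half (p : ℕ) : PowerSeries (ZMod p) := PowerSeries.mk fun i => cantor p (2 * i)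

lemma expand_eq_pow (p : ℕ) [Fact p.Prime] (hp : p ≠ 0) (F : PowerSeries (ZMod p)) :
    PowerSeries.expand p hp F = F ^ p := by
  have := MvPowerSeries.map_frobenius_expand (p := p) hp (f := F)
  rw [ZMod.frobenius_zmod] at this
  rw [← this, MvPowerSeries.map_id]
  rfl

lemma half_rec (p : ℕ) [Fact p.Prime] (hodd : Odd p) :
    half p = (1 + PowerSeries.X) ^ ((p - 1) / 2) * half p ^ p := by
  have hp : 1 < p := (Fact.out : p.Prime).one_lt
  have hp0 : p ≠ 0 := by omega
  have hm : ∀ n, n % p < p := fun n => Nat.mod_lt _ (by omega)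
  rw [← expand_eq_pow p hp0]
  have hpoly : (1 + PowerSeries.X : PowerSeries (ZMod p)) ^ ((p - 1) / 2) =
    (((1 + X) ^ ((p - 1) / 2) : (ZMod p)[X]) : PowerSeries (ZMod p)) := by simp
  ext n
  rw [hpoly, PowerSeries.coeff_mul, Finset.sum_eq_single (n % p, p * (n / p))]
  · rw [PowerSeries.coeff_expand_mul, Polynomial.coeff_coe, coeff_one_add_X_pow]
    simp only [half, PowerSeries.coeff_mk]
    rw [cantor_even p hp hodd]
  · rintro ⟨a, b⟩ hab hne
    rw [Finset.HasAntidiagonal.mem_antidiagonal] at hab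
    simp only at hab ⊢
    rw [Polynomial.coeff_coe, coeff_one_add_X_pow]
    by_cases hb : p ∣ b
    · obtain ⟨c, rfl⟩ := hb
      by_cases ha : a ≤ (p - 1) / 2
      · exfalso
        apply hne
        have hap : a < p := by omega
        have e1 : n % p = a := by
          rw [← hab, Nat.add_mul_mod_self_left, Nat.mod_eq_of_lt hap]
        have e2 : n / p = c := by
          rw [← hab, Nat.add_mul_div_left _ _ (by omega), Nat.div_eq_of_lt hap, zero_add]
        rw [e1, e2]
      · rw [Nat.choose_eq_zero_of_lt (by omega)]; simp
    · rw [PowerSeries.coeff_expand_of_not_dvd _ _ _ hb, mul_zero]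
  · intro h
    exact absurd (Finset.HasAntidiagonal.mem_antidiagonal.2 (Nat.mod_add_div n p)) h

lemma half_sq (p : ℕ) [Fact p.Prime] (hodd : Odd p) :
    (1 + PowerSeries.X) * half p ^ 2 = 1 := by
  have hpr : p.Prime := Fact.out
  obtain ⟨h, hh⟩ := hodd
  have hrec := half_rec p ⟨h, hh⟩
  rw [show (p - 1) / 2 = h by omega] at hrec
  have hcc : PowerSeries.constantCoeff (half p) = 1 := by
    rw [← PowerSeries.coeff_zero_eq_constantCoeff_apply, half, PowerSeries.coeff_mk]
    simp [cantor]
  have h0 : half p ≠ 0 := by intro h0; rw [h0] at hcc; simp at hcc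
  set Z := (1 + PowerSeries.X) * half p ^ 2 with hZ
  have hZc : PowerSeries.constantCoeff Z = 1 := by simp [hZ, hcc]
  have hZh : Z ^ h = 1 := by
    apply mul_right_cancel₀ h0
    rw [hZ, mul_pow, ← pow_mul, one_mul, mul_assoc, ← pow_succ, ← hh]
    exact hrec.symm
  have hg := geom_sum_mul Z h
  rw [hZh, sub_self] at hg
  rcases mul_eq_zero.1 hg with h1 | h1
  · exfalso
    have := congrArg PowerSeries.constantCoeff h1
    simp only [map_sum, map_pow, hZc, one_pow, Finset.sum_const, Finset.card_range, nsmul_eq_mul,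
      mul_one, map_zero] at this
    rw [ZMod.natCast_eq_zero_iff] at this
    have hpos : 0 < h := by
      have := hpr.two_le; omega
    have := Nat.le_of_dvd hpos this
    omega
  · exact sub_eq_zero.1 h1

/-- the even part of the Cantor series, as a Laurent series -/
def halfL (p : ℕ) [Fact p.Prime] : LaurentSeries (ZMod p) :=
  HahnSeries.ofPowerSeries ℤ (ZMod p) (half p)

lemma single_mul_t : (HahnSeries.single (1 : ℤ) (1 : K)) * tLS K = 1 := by
  rw [tLS, HahnSeries.single_mul_single]; simp

lemma halfL_sq (p : ℕ) [Fact p.Prime] (hodd : Odd p) :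
    aeval (tLS (ZMod p)) (X + 1 : (ZMod p)[X]) * halfL p ^ 2 = tLS (ZMod p) := by
  have := congrArg (HahnSeries.ofPowerSeries ℤ (ZMod p)) (half_sq p hodd)
  rw [map_mul, map_add, map_one, map_pow, HahnSeries.ofPowerSeries_X] at this
  rw [halfL, map_add, aeval_X, map_one]
  have h1 := single_mul_t (K := ZMod p)
  linear_combination tLS (ZMod p) * this -
    ((HahnSeries.ofPowerSeries ℤ (ZMod p)) (half p)) ^ 2 * h1

lemma cantorTilde_eq (p : ℕ) [Fact p.Prime] (hodd : Odd p) :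
    cantorTilde p = dbl (ZMod p) (halfL p) := by
  have hp : 1 < p := (Fact.out : p.Prime).one_lt
  ext n
  rcases Int.even_or_odd' n with ⟨m, rfl | rfl⟩
  · rw [dbl_coeff_even, cantorTilde, halfL, PowerSeries.coeff_coe, PowerSeries.coeff_coe]
    by_cases hm : m < 0
    · rw [if_pos (by omega), if_pos hm]
    · rw [if_neg (by omega), if_neg hm, half, PowerSeries.coeff_mk, PowerSeries.coeff_mk]
      congr 1; omega
  · rw [dbl_coeff_odd _ _ ⟨m, rfl⟩, cantorTilde, PowerSeries.coeff_coe]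
    split_ifs with h
    · rfl
    · rw [PowerSeries.coeff_mk]
      apply cantor_odd p hp hodd
      rw [Nat.odd_iff]; omega

lemma main_bound (p : ℕ) [Fact p.Prime] (hodd : Odd p) (k j : ℕ) (hj : Odd j) (hk : 1 ≤ k)
    (n : ℕ) :
    1 - (n : ℝ) / k ≤ eMass (cantorTheta p) (j * p ^ k) n ∧
      eMass (cantorTheta p) (j * p ^ k) n ≤ 1 := by
  have hpr : p.Prime := Fact.out
  obtain ⟨h, hh⟩ : Odd (p ^ k) := hodd.pow
  obtain ⟨b, hb⟩ := hj
  have hkh : k ≤ h := by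
    have h3 : 3 ≤ p := by
      rcases hodd with ⟨c, hc⟩
      have := hpr.two_le
      omega
    have h1 : 3 ^ k ≤ p ^ k := Nat.pow_le_pow_left h3 k
    have h2 : 2 * k + 1 ≤ 3 ^ k := by
      clear * -
      induction k with
      | zero => simp
      | succ k ih => rw [pow_succ]; omega
    omega
  set t := tLS (ZMod p) with ht
  set M := halfL p with hM
  set w := aeval t (X + 1 : (ZMod p)[X]) with hw
  have hwM : w * M ^ 2 = t := halfL_sq p hodd
  set a := b * p ^ k + h with ha
  have haN : j * p ^ k = 2 * a + 1 := by
    rw [ha, hb, add_mul, mul_add, one_mul]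
    rw [hh]; ring
  set B := t ^ a * M with hB
  have hθ : t ^ (j * p ^ k) * cantorTheta p = dbl (ZMod p) B := by
    rw [hB, map_mul, dbl_t, ← cantorTilde_eq p hodd, cantorTheta, haN, ← ht]
    have h1 := single_mul_t (K := ZMod p)
    rw [← ht] at h1
    linear_combination t ^ (2 * a) * cantorTilde p * h1
  have hBw : w * B ^ 2 = t ^ (j * p ^ k) := by
    rw [haN, hB]; linear_combination t ^ (2 * a) * hwM
  have hBg : B = w ^ h * (t ^ b * M) ^ (p ^ k) := by
    rw [mul_pow, ← pow_mul, hB, ha, pow_add]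
    have : w ^ h * M ^ (p ^ k) = t ^ h * M := by
      rw [hh, pow_succ, pow_mul, ← hwM, mul_pow]; ring
    linear_combination -t ^ (b * p ^ k) * this
  have hirr : Irr B := by
    intro U V hV he
    rw [sub_eq_zero] at he
    have hpoly : U ^ 2 * (X + 1) = V ^ 2 * X ^ (j * p ^ k) := by
      apply io_inj
      simp only [map_mul, map_pow, aeval_X]
      rw [← ht, ← hw, ← hBw, ← he]; ring
    have hX : (X : (ZMod p)[X]) ≠ 0 := X_ne_zero
    have hR : V ^ 2 * X ^ (j * p ^ k) ≠ 0 := mul_ne_zero (pow_ne_zero _ hV) (pow_ne_zero _ hX)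
    have hL : U ^ 2 * (X + 1) ≠ 0 := by rw [hpoly]; exact hR
    have hU : U ≠ 0 := by rintro rfl; simp at hL
    have hc := congrArg (rootMultiplicity (-1)) hpoly
    rw [rootMultiplicity_mul hL, rootMultiplicity_mul hR] at hc
    have e1 : rootMultiplicity (-1 : ZMod p) (X + 1) = 1 := by
      have := rootMultiplicity_X_sub_C_self (x := (-1 : ZMod p))
      rwa [C_neg, C_1, sub_neg_eq_add] at this
    have e2 : rootMultiplicity (-1 : ZMod p) (X ^ (j * p ^ k)) = 0 := by
      apply rootMultiplicity_eq_zero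
      simp [IsRoot]
    have e3 : ∀ W : (ZMod p)[X], W ≠ 0 →
        rootMultiplicity (-1 : ZMod p) (W ^ 2) = 2 * rootMultiplicity (-1 : ZMod p) W := by
      intro W hW
      rw [pow_two, rootMultiplicity_mul (mul_ne_zero hW hW)]; ring
    rw [e1, e2, e3 U hU, e3 V hV] at hc
    omega
  have hper : ∃ s : ℕ × ℕ, PeriodWindow B s.1 s.2 := by
    refine periodic B (w * B) ((X + 1) * X ^ (j * p ^ k)) (X + 1) (1 + (w * B).order.natAbs)
      ?_ (by omega) hirr X1_ne (by rw [X1_deg]; omega) rfl (dvd_mul_right _ _)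
    rw [map_mul, map_pow, aeval_X, ← ht, ← hw, ← hBw]; ring
  have hper2 : ∃ s : ℕ × ℕ, PeriodWindow (dbl (ZMod p) B) s.1 s.2 := by
    obtain ⟨s, hs1, hs2⟩ := hper
    refine ⟨s, hs1, fun i hi => ?_⟩
    rw [dbl_cfPQ, dbl_cfPQ, hs2 i hi]
  have hdeg : ∀ i, 1 ≤ i → (k : ℤ) ≤ degZ (cfPQ (dbl (ZMod p) B) i) := by
    intro i hi
    have := pq_bound B hirr h (fun U V hV hcop hpos =>
      key p k h hh B (t ^ b * M) hBg hirr U V hV hcop hpos) i hi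
    rw [dbl_cfPQ, degZ, dbl_order]
    rw [degZ] at this
    omega
  have := eMassOf_bound (dbl (ZMod p) B) hper2 (k : ℤ) (by omega) hdeg n
  rw [eMass, eMassP, ← ht, hθ]
  simpa using this

lemma main_tendsto (p : ℕ) [Fact p.Prime] (hodd : Odd p)
    (j : ℕ → ℕ) (hj : ∀ k : ℕ, Odd (j k)) (n : ℕ) :
    Filter.Tendsto (fun k : ℕ => eMass (cantorTheta p) (j k * p ^ k) n)
          Filter.atTop (nhds 1) := by
  have h1 : Filter.Tendsto (fun k : ℕ => 1 - (n : ℝ) / k) Filter.atTop (nhds 1) := by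
    simpa using (tendsto_const_div_atTop_nhds_zero_nat (n : ℝ)).const_sub 1
  refine tendsto_of_tendsto_of_tendsto_of_le_of_le' h1 tendsto_const_nhds ?_ ?_
  · filter_upwards [eventually_ge_atTop 1] with k hk
    exact (main_bound p hodd k (j k) (hj k) hk n).1
  · filter_upwards [eventually_ge_atTop 1] with k hk
    exact (main_bound p hodd k (j k) (hj k) hk n).2

/-- For any sequence of odd integers `1 ≤ j_k ≤ p − 2`, the diagonals
`{j_k p^k}` exhibit full escape of mass: for every `n ≥ 2`, `lim_k e_{j_k p^k, n}(Θ_p) = 1`,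
and `lim_n lim_k e_{j_k p^k, n}(Θ_p) = 1`. -/
theorem pCantor_full_escape_diagonals (p : ℕ) [Fact p.Prime] (hodd : Odd p)
    (j : ℕ → ℕ) (hj : ∀ k : ℕ, Odd (j k) ∧ 1 ≤ j k ∧ j k ≤ p - 2) :
    (∀ n : ℕ, 2 ≤ n →
        Filter.Tendsto (fun k : ℕ => eMass (cantorTheta p) (j k * p ^ k) n)
          Filter.atTop (nhds 1)) ∧
    ∃ L : ℕ → ℝ,
      (∀ n : ℕ, 2 ≤ n →
        Filter.Tendsto (fun k : ℕ => eMass (cantorTheta p) (j k * p ^ k) n)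
          Filter.atTop (nhds (L n))) ∧
      Filter.Tendsto L Filter.atTop (nhds 1) := by
  refine ⟨fun n _ => main_tendsto p hodd j (fun k => (hj k).1) n, fun _ => 1,
    fun n _ => main_tendsto p hodd j (fun k => (hj k).1) n, tendsto_const_nhds⟩

end EscapeOfMass
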